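/- Let β > 0 and let D : ℝ → ℝ be a smooth function such that |D(x)| + |D'(x)| ≤ C e^{σ|x|} for some σ < 1 + β. Then ∫_ℝ [(D Q^{1+β})'(x)]² dx = ∫_ℝ (D'(x))² Q(x)^{2(1+β)} dx + (1+β) ∫_ℝ D(x)² ( −(1+β) Q(x)^{2+2β} + ((2β+5)/5) Q(x)^{5+2β} ) dx. -/

import Mathlib

open Real MeasureTheory Filter

noncomputable def Q (x : ℝ) : ℝ := (5 / (2 * Real.cosh (3 * x / 2) ^ 2)) ^ ((1:ℝ)/3)

theorem Q_pos (x : ℝ) : 0 < Q x := by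
  have := Real.cosh_pos (3 * x / 2)
  unfold Q
  positivity

theorem tanh_sq_eq_one_sub (x : ℝ) : tanh x ^ 2 = 1 - 1 / cosh x ^ 2 := by
  have := Real.cosh_pos x
  rw [tanh_eq_sinh_div_cosh]
  field_simp
  linarith [Real.cosh_sq x]

theorem abs_tanh_le_one (x : ℝ) : |tanh x| ≤ 1 := by
  rw [← sq_le_one_iff_abs_le_one, tanh_sq_eq_one_sub]
  have : 0 ≤ 1 / cosh x ^ 2 := by positivity
  linarith

theorem Q_rpow_three (x : ℝ) : Q x ^ (3 : ℝ) = 5 / 2 * (1 - tanh (3 * x / 2) ^ 2) := by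
  have := Real.cosh_pos (3 * x / 2)
  rw [Q, ← rpow_mul (by positivity), tanh_sq_eq_one_sub]
  norm_num
  field_simp

theorem hasDerivAt_tanh_three_halves (x : ℝ) :
    HasDerivAt (fun y => tanh (3 * y / 2)) (3 / 2 * (1 - tanh (3 * x / 2) ^ 2)) x := by
  have hc := Real.cosh_pos (3 * x / 2)
  have hl : HasDerivAt (fun y : ℝ => 3 * y / 2) (3 / 2) x := by
    simpa using ((hasDerivAt_id x).const_mul 3).div_const 2
  have h := hl.sinh.fun_div hl.cosh hc.ne'
  simp only [← tanh_eq_sinh_div_cosh] at h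
  refine h.congr_deriv ?_
  rw [tanh_eq_sinh_div_cosh]
  field_simp

theorem hasDerivAt_Q (x : ℝ) : HasDerivAt Q (-tanh (3 * x / 2) * Q x) x := by
  have hc := Real.cosh_pos (3 * x / 2)
  have hl : HasDerivAt (fun y : ℝ => 3 * y / 2) (3 / 2) x := by
    simpa using ((hasDerivAt_id x).const_mul 3).div_const 2
  have h := (((hl.cosh.fun_pow 2).const_mul 2).fun_inv (by positivity)).const_mul 5
  have hg : 0 < 5 / (2 * cosh (3 * x / 2) ^ 2) := by positivity
  simp only [← div_eq_mul_inv] at h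
  refine (h.rpow_const (p := 1 / 3) (Or.inl hg.ne')).congr_deriv ?_
  rw [rpow_sub_one hg.ne', Q, tanh_eq_sinh_div_cosh]
  field_simp
  push_cast
  ring

theorem hasDerivAt_Q_rpow (p x : ℝ) :
    HasDerivAt (fun y => Q y ^ p) (-p * tanh (3 * x / 2) * Q x ^ p) x := by
  refine ((hasDerivAt_Q x).rpow_const (p := p) (Or.inl (Q_pos x).ne')).congr_deriv ?_
  rw [rpow_sub_one (Q_pos x).ne']
  have := Q_pos x
  field_simp

theorem Q_le_exp_neg_abs (x : ℝ) : Q x ≤ 10 ^ ((1 : ℝ) / 3) * exp (-|x|) := by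
  have hc := Real.cosh_pos (3 * x / 2)
  have hexp : exp (-|x|) = exp (-(3 * |x|)) ^ ((1 : ℝ) / 3) := by
    rw [← exp_mul]
    ring_nf
  rw [hexp, ← mul_rpow (by norm_num) (exp_pos _).le, Q]
  refine rpow_le_rpow (by positivity) ?_ (by norm_num)
  have h1 : exp (3 * |x| / 2) ≤ 2 * cosh (3 * x / 2) := by
    have h := exp_abs_le (3 * x / 2)
    rw [abs_div, abs_mul] at h
    norm_num at h
    rw [Real.cosh_eq]
    linarith
  have h2 : exp (3 * |x|) ≤ (2 * cosh (3 * x / 2)) ^ 2 := by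
    have : exp (3 * |x|) = exp (3 * |x| / 2) ^ 2 := by
      rw [← exp_nat_mul]
      push_cast
      ring_nf
    rw [this]
    gcongr
  rw [exp_neg, ← div_eq_mul_inv, div_le_div_iff₀ (by positivity) (exp_pos _)]
  nlinarith

theorem Q_rpow_le_exp {p : ℝ} (hp : 0 ≤ p) (x : ℝ) :
    Q x ^ p ≤ (10 ^ ((1 : ℝ) / 3)) ^ p * exp (-(p * |x|)) := by
  refine (rpow_le_rpow (Q_pos x).le (Q_le_exp_neg_abs x) hp).trans_eq ?_
  rw [mul_rpow (by positivity) (exp_pos _).le, ← exp_mul]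
  ring_nf

theorem integrable_exp_neg_mul_abs {b : ℝ} (hb : 0 < b) :
    Integrable fun x : ℝ => exp (-b * |x|) := by
  rw [← integrableOn_univ, ← Set.Iic_union_Ioi (a := (0 : ℝ)), integrableOn_union]
  refine ⟨(integrableOn_exp_mul_Iic hb 0).congr_fun (fun x hx => ?_) measurableSet_Iic,
    (exp_neg_integrableOn_Ioi 0 hb).congr_fun (fun x hx => ?_) measurableSet_Ioi⟩
  · simp [abs_of_nonpos (Set.mem_Iic.mp hx)]
  · simp [abs_of_pos (Set.mem_Ioi.mp hx)]

/-- A continuous function growing slower than `exp (p |x|)` is integrable against `Q ^ p`. -/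
theorem integrable_mul_Q_rpow {p s M : ℝ} (hp : 0 ≤ p) (hs : s < p) {f : ℝ → ℝ}
    (hf : Continuous f) (hfM : ∀ x, |f x| ≤ M * exp (s * |x|)) :
    Integrable fun x => f x * Q x ^ p := by
  have hQ : Continuous fun x => Q x ^ p :=
    continuous_iff_continuousAt.2 fun x => (hasDerivAt_Q_rpow p x).continuousAt
  refine ((integrable_exp_neg_mul_abs (sub_pos.2 hs)).const_mul
    (M * (10 ^ ((1 : ℝ) / 3)) ^ p)).mono' (hf.mul hQ).aestronglyMeasurable
    (Eventually.of_forall fun x => ?_)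
  have hQp : 0 < Q x ^ p := rpow_pos_of_pos (Q_pos x) p
  rw [norm_eq_abs, abs_mul, abs_of_pos hQp]
  calc |f x| * Q x ^ p
      ≤ (M * exp (s * |x|)) * ((10 ^ ((1 : ℝ) / 3)) ^ p * exp (-(p * |x|))) :=
        mul_le_mul (hfM x) (Q_rpow_le_exp hp x) hQp.le ((abs_nonneg _).trans (hfM x))
    _ = M * (10 ^ ((1 : ℝ) / 3)) ^ p * exp (-(p - s) * |x|) := by
        rw [show -(p - s) * |x| = s * |x| + -(p * |x|) by ring, exp_add]
        ring

/-- The identity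
`∫ ((D Q^{1+β})')² = ∫ (D')² Q^{2(1+β)} + (1+β) ∫ D² (−(1+β) Q^{2+2β} + ((2β+5)/5) Q^{5+2β})`
for smooth `D` with subcritical exponential growth. -/
theorem weighted_derivative_identity
    (β : ℝ) (hβ : 0 < β) (D : ℝ → ℝ) (hD : ContDiff ℝ (⊤ : ℕ∞) D)
    (σ C : ℝ) (hσ : σ < 1 + β)
    (hgrowth : ∀ x : ℝ, |D x| + |deriv D x| ≤ C * Real.exp (σ * |x|)) :
    (∫ x : ℝ, (deriv (fun y => D y * Q y ^ (1 + β)) x) ^ 2)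
      = (∫ x : ℝ, (deriv D x) ^ 2 * Q x ^ (2 * (1 + β)))
        + (1 + β) * ∫ x : ℝ, (D x) ^ 2
            * (-(1 + β) * Q x ^ (2 + 2 * β) + ((2 * β + 5) / 5) * Q x ^ (5 + 2 * β)) := by
  set a := 1 + β with ha
  have ha0 : 0 < a := by linarith
  set t : ℝ → ℝ := fun x => tanh (3 * x / 2) with ht
  have ht1 : ∀ x, |t x| ≤ 1 := fun x => abs_tanh_le_one _
  have htd : ∀ x, HasDerivAt t (3 / 2 * (1 - t x ^ 2)) x := hasDerivAt_tanh_three_halves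
  have htc : Continuous t := continuous_iff_continuousAt.2 fun x => (htd x).continuousAt
  have hDd : ∀ x, HasDerivAt D (deriv D x) x := fun x =>
    (hD.differentiable (by simp) x).hasDerivAt
  have hDc : Continuous D := hD.continuous
  have hD'c : Continuous (deriv D) := hD.continuous_deriv (by simp)
  have integrable_of_le : ∀ f : ℝ → ℝ, Continuous f →
      (∀ x, |f x| ≤ (|D x| + |deriv D x|) ^ 2) →
      Integrable fun x => f x * Q x ^ (2 * a) := by
    intro f hf hfM
    refine integrable_mul_Q_rpow (s := 2 * σ) (M := C ^ 2) (by linarith) (by linarith) hf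
      fun x => (hfM x).trans ?_
    have hexp : exp (2 * σ * |x|) = exp (σ * |x|) ^ 2 := by
      rw [← exp_nat_mul]
      push_cast
      ring_nf
    rw [hexp, ← mul_pow]
    gcongr
    exact hgrowth x
  have hDsq : ∀ x, |D x| ^ 2 ≤ (|D x| + |deriv D x|) ^ 2 := fun x => by
    gcongr
    linarith [abs_nonneg (deriv D x)]
  have hD'sq : ∀ x, |deriv D x| ^ 2 ≤ (|D x| + |deriv D x|) ^ 2 := fun x => by
    gcongr
    linarith [abs_nonneg (D x)]
  have hR : Integrable fun x => deriv D x ^ 2 * Q x ^ (2 * a) :=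
    integrable_of_le _ (hD'c.pow 2) fun x => by
      rw [abs_pow]
      exact hD'sq x
  have hP : Integrable fun x => D x ^ 2 * Q x ^ (2 * a) :=
    integrable_of_le _ (hDc.pow 2) fun x => by
      rw [abs_pow]
      exact hDsq x
  have hS : Integrable fun x => (t x * (D x * deriv D x)) * Q x ^ (2 * a) :=
    integrable_of_le _ (htc.mul (hDc.mul hD'c)) fun x => by
      rw [abs_mul, abs_mul]
      have h0 : 0 ≤ |D x| * |deriv D x| := by positivity
      nlinarith [ht1 x, sq_nonneg (|D x|), sq_nonneg (|deriv D x|)]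
  have hT : Integrable fun x => (t x * D x ^ 2) * Q x ^ (2 * a) :=
    integrable_of_le _ (htc.mul (hDc.pow 2)) fun x => by
      rw [abs_mul, abs_pow]
      nlinarith [ht1 x, hDsq x, sq_nonneg (|D x|)]
  have hU : Integrable fun x => (t x ^ 2 * D x ^ 2) * Q x ^ (2 * a) :=
    integrable_of_le _ ((htc.pow 2).mul (hDc.pow 2)) fun x => by
      rw [abs_mul, abs_pow, abs_pow]
      have := pow_le_one₀ (n := 2) (abs_nonneg _) (ht1 x)
      nlinarith [hDsq x, sq_nonneg (|D x|)]
  have hlhs : ∀ x, deriv (fun y => D y * Q y ^ a) x ^ 2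
      = (deriv D x - a * t x * D x) ^ 2 * Q x ^ (2 * a) := fun x => by
    have hsq : Q x ^ (2 * a) = (Q x ^ a) ^ 2 := by
      rw [mul_comm, rpow_mul (Q_pos x).le, rpow_two]
    rw [((hDd x).fun_mul (hasDerivAt_Q_rpow a x)).deriv, hsq]
    ring
  have hrhs : ∀ x, D x ^ 2 * (-a * Q x ^ (2 + 2 * β) + ((2 * β + 5) / 5) * Q x ^ (5 + 2 * β))
      = (3 / 2) * (D x ^ 2 * Q x ^ (2 * a))
        - (a + 3 / 2) * ((t x ^ 2 * D x ^ 2) * Q x ^ (2 * a)) := fun x => by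
    rw [show 2 + 2 * β = 2 * a by rw [ha]; ring, show 5 + 2 * β = 2 * a + 3 by rw [ha]; ring,
      rpow_add (Q_pos x), Q_rpow_three, show β = a - 1 by rw [ha]; ring]
    ring
  have hzero : ∫ x, (-(2 * a) * ((t x * (D x * deriv D x)) * Q x ^ (2 * a))
      - 3 / 2 * a * (D x ^ 2 * Q x ^ (2 * a))
      + (2 * a ^ 2 + 3 / 2 * a) * ((t x ^ 2 * D x ^ 2) * Q x ^ (2 * a))) = 0 := by
    refine integral_eq_zero_of_hasDerivAt_of_integrable
      (f := fun x => -a * ((t x * D x ^ 2) * Q x ^ (2 * a))) (fun x => ?_)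
      (((hS.const_mul _).sub (hP.const_mul _)).add (hU.const_mul _)) (hT.const_mul _)
    refine ((((htd x).fun_mul ((hDd x).fun_pow 2)).fun_mul
      (hasDerivAt_Q_rpow (2 * a) x)).const_mul (-a)).congr_deriv ?_
    simp only [ht]
    push_cast
    ring
  have hV : Integrable fun x => a * ((3 / 2) * (D x ^ 2 * Q x ^ (2 * a))
      - (a + 3 / 2) * ((t x ^ 2 * D x ^ 2) * Q x ^ (2 * a))) :=
    ((hP.const_mul _).sub (hU.const_mul _)).const_mul _
  simp only [hlhs, hrhs]
  rw [← integral_const_mul, ← integral_add hR hV, ← sub_eq_zero, ← integral_sub]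
  · rw [← hzero]
    congr 1 with x
    ring
  · refine ((hR.sub (hS.const_mul (2 * a))).add (hU.const_mul (a ^ 2))).congr
      (Eventually.of_forall fun x => ?_)
    simp only [Pi.add_apply, Pi.sub_apply]
    ring
  · exact hR.add hV
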